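/- Let f^{•,•} : S^{•,•} → T^{•,•} be a morphism of locally finite double complexes in an additive category 𝒜. If for each q ∈ ℤ the map of single complexes f^{•,q} : S^{•,q} → T^{•,q} is a homotopy equivalence, then the induced map on total complexes Tot(f) : Tot(S^{•,•}) → Tot(T^{•,•}) is a homotopy equivalence. -/

import Mathlib

/-!
STATEMENT 1 (Kahn–Miyazaki–Saito–Yamazaki, "Motives with modulus III", Lemma B.5 (2)):
If `f^{•,•} : S^{•,•} → T^{•,•}` is a morphism of locally finite double complexes in an
additive category `𝒜` such that each `f^{•,q} : S^{•,q} → T^{•,q}` is a homotopy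
equivalence, then `Tot(f) : Tot(S) → Tot(T)` is a homotopy equivalence.

The double complexes are encoded as in Statement 0: the outer index is `q`, so that
`K.X q` is the single complex `S^{•,q}` with the first differential.
-/

open CategoryTheory CategoryTheory.Limits HomologicalComplex

universe v u

/-- A presentation of the terms of a cochain complex `C` as the coproducts of the objects
`(X q).X p` for `q + p = n`, such that the differential of `C` is the sum of (up to signs) the
differentials of the rows `X q` and of maps `v` raising `q` by one. -/
structure CochainComplex.RowDecomposition {𝒞 : Type u} [Category.{v} 𝒞] [Preadditive 𝒞]
    (C : CochainComplex 𝒞 ℤ) (X : ℤ → CochainComplex 𝒞 ℤ) where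
  /-- the inclusion of a summand -/
  ι (q p n : ℤ) (h : q + p = n) : (X q).X p ⟶ C.X n
  /-- the vertical maps -/
  v (q q' p : ℤ) : (X q).X p ⟶ (X q').X p
  ι_d (q q' p p' n m : ℤ) (hq : q + 1 = q') (hp : p + 1 = p') (h : q + p = n) (hm : n + 1 = m) :
    ι q p n h ≫ C.d n m = v q q' p ≫ ι q' p m (by lia) +
      q.negOnePow • ((X q).d p p' ≫ ι q p' m (by lia))
  exists_desc (n : ℤ) {Z : 𝒞} (f : ∀ q p : ℤ, q + p = n → ((X q).X p ⟶ Z)) :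
    ∃ g : C.X n ⟶ Z, ∀ q p h, ι q p n h ≫ g = f q p h
  hom_ext {n : ℤ} {Z : 𝒞} {g g' : C.X n ⟶ Z}
    (h : ∀ q p h, ι q p n h ≫ g = ι q p n h ≫ g') : g = g'

namespace CochainComplex.RowDecomposition

variable {𝒞 : Type u} [Category.{v} 𝒞] [Preadditive 𝒞]
  {C : CochainComplex 𝒞 ℤ} {X : ℤ → CochainComplex 𝒞 ℤ}

/-- An endomorphism which raises the row index by one is nilpotent when only finitely many rows
contribute. -/
lemma isNilpotent (R : RowDecomposition C X) {n a b : ℤ}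
    (hzero : ∀ q p, q + p = n → (q < a ∨ b < q) → IsZero ((X q).X p))
    (N : End (C.X n))
    (w : ∀ q p : ℤ, (X q).X p ⟶ (X (q + 1)).X (p - 1))
    (hN : ∀ q p h, R.ι q p n h ≫ (N : C.X n ⟶ C.X n) = w q p ≫ R.ι (q + 1) (p - 1) n (by lia)) :
    IsNilpotent N := by
  have key (r : ℕ) : ∀ q p h, b < q + r → R.ι q p n h ≫ (N ^ r : End (C.X n)) = 0 := by
    induction r with
    | zero =>
      intro q p h hb
      exact (hzero q p h (Or.inr (by simpa using hb))).eq_of_src _ _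
    | succ r ih =>
      intro q p h hb
      rw [pow_succ, End.mul_def, reassoc_of% (hN q p h), ih _ _ _ (by push_cast at hb; lia),
        comp_zero]
  refine ⟨(b + 1 - a).toNat, R.hom_ext fun q p h ↦ ?_⟩
  by_cases hq : q < a
  · exact (hzero q p h (Or.inl hq)).eq_of_src _ _
  · exact (key _ q p h (by lia)).trans comp_zero.symm

/-- A complex which is built from contractible rows is contractible. -/
lemma nonempty_homotopy_id_zero (R : RowDecomposition C X)
    (hzero : ∀ n : ℤ, ∃ a b : ℤ, ∀ q p, q + p = n → (q < a ∨ b < q) → IsZero ((X q).X p))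
    (hX : ∀ q, Nonempty (Homotopy (𝟙 (X q)) 0)) :
    Nonempty (Homotopy (𝟙 C) 0) := by
  have s (q : ℤ) := (hX q).some
  have hs (q p₀ p p₁ : ℤ) (h₀ : p₀ + 1 = p) (h₁ : p + 1 = p₁) :
      (X q).d p p₁ ≫ (s q).hom p₁ p + (s q).hom p p₀ ≫ (X q).d p₀ p = 𝟙 _ := by
    have := (s q).comm p
    rw [dNext_eq _ (show (ComplexShape.up ℤ).Rel p p₁ from h₁),
      prevD_eq _ (show (ComplexShape.up ℤ).Rel p₀ p from h₀)] at this
    simpa using this.symm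
  choose S hS using fun n m : ℤ ↦ R.exists_desc n (Z := C.X m) (fun q p _ ↦
    q.negOnePow • ((s q).hom p (m - q) ≫ R.ι q (m - q) m (by lia)))
  have hS' (q p p' n m : ℤ) (h : q + p = n) (h' : q + p' = m) : R.ι q p n h ≫ S n m =
      q.negOnePow • ((s q).hom p p' ≫ R.ι q p' m h') := by
    obtain rfl : p' = m - q := by lia
    exact hS _ _ _ _ _
  let U : C ⟶ C := Homotopy.nullHomotopicMap' (fun i j _ ↦ S i j)
  have hU (n : ℤ) : U.f n = C.d n (n + 1) ≫ S (n + 1) n + S n (n - 1) ≫ C.d (n - 1) n :=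
    Homotopy.nullHomotopicMap'_f (c := ComplexShape.up ℤ) (by simp) (by simp) _
  have hiso (n : ℤ) : IsIso (U.f n) := by
    obtain ⟨a, b, hab⟩ := hzero n
    let N : End (C.X n) := 1 - (show End (C.X n) from U.f n)
    have hN : IsNilpotent N := by
      refine R.isNilpotent hab N (fun q p ↦ q.negOnePow •
        (R.v q (q + 1) p ≫ (s (q + 1)).hom p (p - 1) -
          (s q).hom p (p - 1) ≫ R.v q (q + 1) (p - 1))) (fun q p h ↦ ?_)
      have h1 : (N : C.X n ⟶ C.X n) = 𝟙 _ - U.f n := rfl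
      have h2 := hs q (p - 1) p (p + 1) (by lia) rfl
      rw [h1, hU, Preadditive.comp_sub, Preadditive.comp_add,
        reassoc_of% (R.ι_d q (q + 1) p (p + 1) n (n + 1) rfl rfl h rfl),
        reassoc_of% (hS' q p (p - 1) n (n - 1) h (by lia)), Category.comp_id]
      simp only [Preadditive.add_comp, Category.assoc, Linear.units_smul_comp,
        hS' (q + 1) p (p - 1) (n + 1) n (by lia) (by lia),
        hS' q (p + 1) p (n + 1) n (by lia) h,
        R.ι_d q (q + 1) (p - 1) p (n - 1) n rfl (by lia) (by lia) (by lia),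
        Linear.comp_units_smul, Preadditive.comp_add, Preadditive.sub_comp, smul_sub, smul_add,
        smul_smul, Int.units_mul_self, one_smul, Int.negOnePow_succ, Units.neg_smul,
        Preadditive.comp_neg]
      have h3 := h2 =≫ R.ι q p n h
      simp only [Preadditive.add_comp, Category.assoc, Category.id_comp] at h3
      rw [eq_sub_of_add_eq h3]
      abel
    have := hN.isUnit_one_sub
    rw [sub_sub_cancel] at this
    exact (isUnit_iff_isIso _).1 this
  have : IsIso U := HomologicalComplex.Hom.isIso_of_components U
  have e : Homotopy U 0 := Homotopy.nullHomotopy' _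
  exact ⟨(Homotopy.ofEq (by simp)).trans ((e.compRight (inv U)).trans (Homotopy.ofEq (by simp)))⟩

end CochainComplex.RowDecomposition

namespace HomologicalComplex₂

variable {𝒜 : Type*} [Category 𝒜] [Preadditive 𝒜]
  {𝒞 : Type*} [Category 𝒞] [Preadditive 𝒞] (F : 𝒜 ⥤ 𝒞) [F.Additive]
  {K L : HomologicalComplex₂ 𝒜 (ComplexShape.up ℤ) (ComplexShape.up ℤ)}
  [K.HasTotal (ComplexShape.up ℤ)] [L.HasTotal (ComplexShape.up ℤ)]

lemma ιTotal_d (q q' p p' n m : ℤ) (hq : q + 1 = q') (hp : p + 1 = p') (h : q + p = n)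
    (hm : n + 1 = m) :
    K.ιTotal (ComplexShape.up ℤ) q p n h ≫ (K.total (ComplexShape.up ℤ)).d n m =
      (K.d q q').f p ≫ K.ιTotal (ComplexShape.up ℤ) q' p m (by dsimp; lia) +
      q.negOnePow • ((K.X q).d p p' ≫ K.ιTotal (ComplexShape.up ℤ) q p' m (by dsimp; lia)) := by
  dsimp only [total_d]
  rw [Preadditive.comp_add, ι_D₁, ι_D₂,
    d₁_eq K _ (show (ComplexShape.up ℤ).Rel q q' from hq) p m (by dsimp; lia),
    d₂_eq K _ q (show (ComplexShape.up ℤ).Rel p p' from hp) m (by dsimp; lia)]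
  simp

variable (K) in
/-- The image by `F` of the inclusion of a summand in the total complex. -/
noncomputable def mapιTotal (q p n : ℤ) (h : q + p = n) :
    ((F.mapHomologicalComplex (ComplexShape.up ℤ)).obj (K.X q)).X p ⟶
      ((F.mapHomologicalComplex _).obj (K.total (ComplexShape.up ℤ))).X n :=
  F.map (K.ιTotal (ComplexShape.up ℤ) q p n h)

lemma mapιTotal_d (q q' p p' n m : ℤ) (hq : q + 1 = q') (hp : p + 1 = p') (h : q + p = n)
    (hm : n + 1 = m) :
    mapιTotal F K q p n h ≫
        ((F.mapHomologicalComplex _).obj (K.total (ComplexShape.up ℤ))).d n m =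
      ((F.mapHomologicalComplex _).map (K.d q q')).f p ≫ mapιTotal F K q' p m (by lia) +
      q.negOnePow • (((F.mapHomologicalComplex (ComplexShape.up ℤ)).obj (K.X q)).d p p' ≫
        mapιTotal F K q p' m (by lia)) := by
  have := congr_arg F.map (K.ιTotal_d q q' p p' n m hq hp h hm)
  simp only [F.map_add, F.map_comp, Units.smul_def, F.map_zsmul] at this
  exact this

lemma mapιTotal_map (φ : K ⟶ L) (q p n : ℤ) (h : q + p = n) :
    mapιTotal F K q p n h ≫ ((F.mapHomologicalComplex _).map
        (total.map φ (ComplexShape.up ℤ))).f n =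
      ((F.mapHomologicalComplex _).map (φ.f q)).f p ≫ mapιTotal F L q p n h := by
  have := congr_arg F.map (ιTotal_map _ _ φ (ComplexShape.up ℤ) q p n h)
  simp only [F.map_comp] at this
  exact this

section Finite

variable {n : ℤ}

omit [K.HasTotal (ComplexShape.up ℤ)] in
lemma exists_bounds (hfin : {p : ℤ | ¬ IsZero ((K.X (n - p)).X p)}.Finite) :
    ∃ a b : ℤ, ∀ q p, q + p = n → (q < a ∨ b < q) → IsZero ((K.X q).X p) := by
  obtain ⟨a, ha⟩ := hfin.bddBelow
  obtain ⟨b, hb⟩ := hfin.bddAbove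
  refine ⟨n - b, n - a, fun q p h hq ↦ ?_⟩
  by_contra hz
  obtain rfl : q = n - p := by lia
  have h1 := ha (show p ∈ {p : ℤ | ¬ IsZero ((K.X (n - p)).X p)} from hz)
  have h2 := hb (show p ∈ {p : ℤ | ¬ IsZero ((K.X (n - p)).X p)} from hz)
  lia

variable (K n) in
lemma exists_totalπ :
    ∃ π : ∀ p : ℤ, (K.total (ComplexShape.up ℤ)).X n ⟶ (K.X (n - p)).X p,
      (∀ p h, K.ιTotal (ComplexShape.up ℤ) (n - p) p n h ≫ π p = 𝟙 _) ∧
      ∀ p p' h, p ≠ p' → K.ιTotal (ComplexShape.up ℤ) (n - p) p n h ≫ π p' = 0 := by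
  refine ⟨fun p ↦ K.totalDesc (fun q p' h ↦ if hp : p' = p then
      (K.XXIsoOfEq _ _ _ (by dsimp at h; lia) hp).hom else 0), fun p h ↦ ?_, fun p p' h hp ↦ ?_⟩
  · simp [XXIsoOfEq]
  · simp [hp]

variable (hfin : {p : ℤ | ¬ IsZero ((K.X (n - p)).X p)}.Finite)

include hfin

lemma exists_map_total_desc {Z : 𝒞}
    (f : ∀ q p : ℤ, q + p = n →
      (((F.mapHomologicalComplex (ComplexShape.up ℤ)).obj (K.X q)).X p ⟶ Z)) :
    ∃ g : ((F.mapHomologicalComplex _).obj (K.total (ComplexShape.up ℤ))).X n ⟶ Z,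
      ∀ q p (h : q + p = n), mapιTotal F K q p n h ≫ g = f q p h := by
  change ∀ q p : ℤ, q + p = n → (F.obj ((K.X q).X p) ⟶ Z) at f
  change ∃ g : F.obj ((K.total (ComplexShape.up ℤ)).X n) ⟶ Z, ∀ q p (h : q + p = n),
    F.map (K.ιTotal (ComplexShape.up ℤ) q p n h) ≫ g = f q p h
  obtain ⟨π, hπ, hπ'⟩ := exists_totalπ K n
  refine ⟨∑ p ∈ hfin.toFinset, F.map (π p) ≫ f (n - p) p (by lia), fun q p h ↦ ?_⟩
  obtain rfl : q = n - p := by lia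
  by_cases hz : IsZero ((K.X (n - p)).X p)
  · exact (F.map_isZero hz).eq_of_src _ _
  rw [Preadditive.comp_sum, Finset.sum_eq_single p]
  · rw [← F.map_comp_assoc, hπ, F.map_id, Category.id_comp]
  · intro p' _ hp'
    rw [← F.map_comp_assoc, hπ' _ _ _ hp'.symm, F.map_zero, zero_comp]
  · intro hp
    exact (hp (by simpa using hz)).elim

lemma map_total_hom_ext {Z : 𝒞}
    {g g' : ((F.mapHomologicalComplex _).obj (K.total (ComplexShape.up ℤ))).X n ⟶ Z}
    (h : ∀ q p (h : q + p = n), mapιTotal F K q p n h ≫ g =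
      mapιTotal F K q p n h ≫ g') : g = g' := by
  change F.obj ((K.total (ComplexShape.up ℤ)).X n) ⟶ Z at g g'
  change ∀ q p (h : q + p = n), F.map (K.ιTotal (ComplexShape.up ℤ) q p n h) ≫ g =
    F.map (K.ιTotal (ComplexShape.up ℤ) q p n h) ≫ g' at h
  obtain ⟨π, hπ, hπ'⟩ := exists_totalπ K n
  have hsum : ∑ p ∈ hfin.toFinset, π p ≫ K.ιTotal (ComplexShape.up ℤ) (n - p) p n (by dsimp; lia)
      = 𝟙 _ := by
    ext q p hqp
    obtain rfl : q = n - p := by dsimp at hqp; lia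
    by_cases hz : IsZero ((K.X (n - p)).X p)
    · exact hz.eq_of_src _ _
    rw [Preadditive.comp_sum, Finset.sum_eq_single p]
    · rw [reassoc_of% (hπ p hqp), Category.comp_id]
    · intro p' _ hp'
      rw [reassoc_of% (hπ' _ _ hqp hp'.symm), zero_comp]
    · intro hp
      exact (hp (by simpa using hz)).elim
  rw [← Category.id_comp g, ← Category.id_comp g', ← F.map_id, ← hsum]
  simp only [F.map_sum, Preadditive.sum_comp, F.map_comp, Category.assoc]
  exact Finset.sum_congr rfl fun p _ ↦ by rw [h]

end Finite

open CochainComplex in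
/-- The mapping cone of `F.map (Tot φ)` is built from the mapping cones of the rows of `φ`. -/
noncomputable def rowDecompositionMappingCone [HasBinaryBiproducts 𝒞] (φ : K ⟶ L)
    (hfinK : ∀ n : ℤ, {p : ℤ | ¬ IsZero ((K.X (n - p)).X p)}.Finite)
    (hfinL : ∀ n : ℤ, {p : ℤ | ¬ IsZero ((L.X (n - p)).X p)}.Finite) :
    RowDecomposition
      (mappingCone ((F.mapHomologicalComplex _).map (total.map φ (ComplexShape.up ℤ))))
      (fun q ↦ mappingCone ((F.mapHomologicalComplex (ComplexShape.up ℤ)).map (φ.f q))) where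
  ι q p n h :=
    (mappingCone.fst _).1.v p (p + 1) rfl ≫
      (q.negOnePow • mapιTotal F K q (p + 1) (n + 1) (by lia)) ≫
        (mappingCone.inl _).v (n + 1) n (by lia) +
    (mappingCone.snd _).v p p (add_zero p) ≫ mapιTotal F L q p n h ≫ (mappingCone.inr _).f n
  v q q' p :=
    (mappingCone.fst _).1.v p (p + 1) rfl ≫ ((F.mapHomologicalComplex _).map (K.d q q')).f (p + 1) ≫
      (mappingCone.inl _).v (p + 1) p (by lia) +
    (mappingCone.snd _).v p p (add_zero p) ≫ ((F.mapHomologicalComplex _).map (L.d q q')).f p ≫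
      (mappingCone.inr _).f p
  ι_d q q' p p' n m hq hp h hm := by
    subst hq hp hm
    apply mappingCone.ext_from _ (p + 1) p rfl
    · simp only [Preadditive.add_comp, Preadditive.comp_add, Category.assoc,
        Linear.units_smul_comp, Linear.comp_units_smul, mappingCone.inl_v_fst_v_assoc,
        mappingCone.inl_v_snd_v_assoc, mappingCone.inr_f_fst_v_assoc,
        mappingCone.inr_f_snd_v_assoc, zero_comp, comp_zero, add_zero, zero_add, smul_zero,
        mappingCone.inl_v_d _ (n + 1) n (n + 1 + 1) (by lia) (by lia),
        mappingCone.inl_v_d_assoc _ (p + 1) p (p + 1 + 1) (by lia) (by lia),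
        Preadditive.comp_sub, Preadditive.sub_comp, reassoc_of% (mapιTotal_map F φ),
        reassoc_of% (mapιTotal_d F q (q + 1) (p + 1) (p + 1 + 1) (n + 1) (n + 1 + 1) rfl rfl
          (by lia) rfl),
        smul_add, smul_sub, smul_smul, Int.units_mul_self, one_smul, Int.negOnePow_succ,
        Units.neg_smul, Preadditive.neg_comp, Preadditive.comp_neg]
      abel
    · simp only [Preadditive.add_comp, Preadditive.comp_add, Category.assoc,
        Linear.units_smul_comp, Linear.comp_units_smul, mappingCone.inr_f_fst_v_assoc,
        mappingCone.inr_f_snd_v_assoc, mappingCone.inr_f_d, mappingCone.inr_f_d_assoc,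
        reassoc_of% (mapιTotal_d F q (q + 1) p (p + 1) n (n + 1) rfl rfl h rfl),
        zero_comp, comp_zero, zero_add, smul_zero]
  exists_desc n Z f := by
    obtain ⟨a, ha⟩ := K.exists_map_total_desc F (hfinK (n + 1)) (fun q p h ↦
      q.negOnePow • ((mappingCone.inl _).v p (p - 1) (by lia) ≫ f q (p - 1) (by lia)))
    obtain ⟨b, hb⟩ := L.exists_map_total_desc F (hfinL n) (fun q p h ↦
      (mappingCone.inr _).f p ≫ f q p h)
    have ha' (q p p' : ℤ) (hp : p + 1 = p') (h : q + p = n) (h' : q + p' = n + 1) :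
        mapιTotal F K q p' (n + 1) h' ≫ a =
          q.negOnePow • ((mappingCone.inl ((F.mapHomologicalComplex _).map (φ.f q))).v p' p
            (by rw [← hp, add_neg_cancel_right]) ≫ f q p h) := by
      obtain rfl : p = p' - 1 := by rw [← hp, add_sub_cancel_right]
      exact ha _ _ _
    refine ⟨(mappingCone.fst _).1.v n (n + 1) rfl ≫ a + (mappingCone.snd _).v n n (add_zero n) ≫ b,
      fun q p h ↦ ?_⟩
    apply mappingCone.ext_from _ (p + 1) p rfl
    · simp [ha' q p _ rfl h (by rw [← h, add_assoc]), smul_smul]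
    · simp [hb]
  hom_ext {n Z g g'} hg := by
    apply mappingCone.ext_from _ (n + 1) n rfl
    · refine K.map_total_hom_ext F (hfinK (n + 1)) (fun q p h ↦ ?_)
      obtain ⟨p, rfl⟩ : ∃ p', p = p' + 1 := ⟨p - 1, by lia⟩
      have := (mappingCone.inl _).v (p + 1) p (by lia) ≫= hg q p (by lia)
      simpa using this
    · refine L.map_total_hom_ext F (hfinL n) (fun q p h ↦ ?_)
      have := (mappingCone.inr _).f p ≫= hg q p h
      simpa using this

end HomologicalComplex₂

/-- A morphism of cochain complexes is a homotopy equivalence if and only if its mapping cone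
is contractible. -/
lemma CochainComplex.mappingCone.nonempty_homotopy_id_zero_iff {𝒞 : Type*} [Category 𝒞]
    [Preadditive 𝒞] [HasZeroObject 𝒞] [HasBinaryBiproducts 𝒞] {K L : CochainComplex 𝒞 ℤ}
    (f : K ⟶ L) :
    Nonempty (Homotopy (𝟙 (mappingCone f)) 0) ↔ homotopyEquivalences _ _ f := by
  rw [← isIso_quotient_map_iff_homotopyEquivalences, ← HomotopyCategory.isZero_quotient_obj_iff]
  exact Pretriangulated.Triangle.isZero₃_iff_isIso₁ _
    (HomotopyCategory.mappingCone_triangleh_distinguished f)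

/-- A fully faithful additive functor preserves and reflects homotopy equivalences. -/
lemma HomologicalComplex.homotopyEquivalences_map_iff {𝒜 𝒞 : Type*} [Category 𝒜] [Category 𝒞]
    [Preadditive 𝒜] [Preadditive 𝒞] (F : 𝒜 ⥤ 𝒞) [F.Additive] [F.Full] [F.Faithful]
    {K L : CochainComplex 𝒜 ℤ} (f : K ⟶ L) :
    homotopyEquivalences _ _ ((F.mapHomologicalComplex (ComplexShape.up ℤ)).map f) ↔
      homotopyEquivalences _ _ f := by
  rw [← isIso_quotient_map_iff_homotopyEquivalences, ← isIso_quotient_map_iff_homotopyEquivalences,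
    ← isIso_iff_of_reflects_iso _ (F.mapHomotopyCategory (ComplexShape.up ℤ))]
  rfl

theorem total_map_homotopyEquiv_of_levelwise
    {𝒜 : Type*} [Category 𝒜] [Preadditive 𝒜]
    (K L : HomologicalComplex₂ 𝒜 (ComplexShape.up ℤ) (ComplexShape.up ℤ))
    [K.HasTotal (ComplexShape.up ℤ)] [L.HasTotal (ComplexShape.up ℤ)]
    -- local finiteness of both double complexes
    (hfinK : ∀ n : ℤ, {p : ℤ | ¬ IsZero ((K.X (n - p)).X p)}.Finite)
    (hfinL : ∀ n : ℤ, {p : ℤ | ¬ IsZero ((L.X (n - p)).X p)}.Finite)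
    (φ : K ⟶ L)
    -- each `f^{•,q} : S^{•,q} → T^{•,q}` is a homotopy equivalence
    (hlev : ∀ q : ℤ, ∃ e : HomotopyEquiv (K.X q) (L.X q), e.hom = φ.f q) :
    ∃ e : HomotopyEquiv (K.total (ComplexShape.up ℤ)) (L.total (ComplexShape.up ℤ)),
      e.hom = HomologicalComplex₂.total.map φ (ComplexShape.up ℤ) := by
  have : HasZeroObject (Mat_ 𝒜) := hasZeroObject_of_hasFiniteBiproducts _
  have : HasBinaryBiproducts (Mat_ 𝒜) := hasBinaryBiproducts_of_finite_biproducts _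
  let F := Mat_.embedding 𝒜
  refine (homotopyEquivalences_map_iff F _).1
    ((CochainComplex.mappingCone.nonempty_homotopy_id_zero_iff _).1
      ((HomologicalComplex₂.rowDecompositionMappingCone F φ hfinK
        hfinL).nonempty_homotopy_id_zero (fun n ↦ ?_) (fun q ↦ ?_)))
  · obtain ⟨a, b, hab⟩ := K.exists_bounds (hfinK (n + 1))
    obtain ⟨a', b', hab'⟩ := L.exists_bounds (hfinL n)
    refine ⟨min a a', max b b', fun q p h hq ↦ ?_⟩
    rw [CochainComplex.mappingCone.isZero_X_iff]
    exact ⟨F.map_isZero (hab q (p + 1) (by lia) (by lia)),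
      F.map_isZero (hab' q p h (by lia))⟩
  · exact (CochainComplex.mappingCone.nonempty_homotopy_id_zero_iff _).2
      ((homotopyEquivalences_map_iff F _).2 (hlev q))
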